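/- arXiv:2601.12750 — 4 statements merged into one kernel-verified Lean document; each statement's English description precedes it below -/
import Mathlib

section
/- For every hiring policy H there exists a canonical hiring policy H̃ whose total expected reward satisfies R(H̃) ≥ R(H). -/
/-- A hiring policy: assigns to every state `(t, κ, A)` an applicant. -/
def Policy (n : ℕ) : Type := ℕ → ℕ → Finset (Fin n) → Fin n

/-- A hiring policy is valid if at every state `(t, κ, A)` with `1 ≤ t ≤ T`,
`1 ≤ κ ≤ k`, and `A ≠ ∅`, it selects an available applicant. -/
def ValidPolicy (n k T : ℕ) (H : Policy n) : Prop :=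
  ∀ t κ : ℕ, ∀ A : Finset (Fin n), 1 ≤ t → t ≤ T → 1 ≤ κ → κ ≤ k → A.Nonempty →
    H t κ A ∈ A

/-- Expected reward, with explicit fuel `T + 1 - t`. -/
noncomputable def rewardAux {n : ℕ} (v p : Fin n → ℝ) (H : Policy n) :
    ℕ → ℕ → ℕ → Finset (Fin n) → ℝ
  | 0, _, _, _ => 0
  | fuel + 1, t, κ, A =>
    if κ = 0 ∨ A = ∅ then 0
    else
      p (H t κ A) * (v (H t κ A) +
          rewardAux v p H fuel (t + 1) (κ - 1) (A.erase (H t κ A))) +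
        (1 - p (H t κ A)) * rewardAux v p H fuel (t + 1) κ (A.erase (H t κ A))

/-- Expected reward `R_H(t, κ, A)` of policy `H` from state `(t, κ, A)`;
it vanishes as soon as `t = T + 1`, `κ = 0`, or `A = ∅`. -/
noncomputable def reward {n : ℕ} (v p : Fin n → ℝ) (T : ℕ) (H : Policy n)
    (t κ : ℕ) (A : Finset (Fin n)) : ℝ :=
  rewardAux v p H (T + 1 - t) t κ A

/-- Total expected reward `R(H) = R_H(1, k, [n])`. -/
noncomputable def totalReward {n : ℕ} (v p : Fin n → ℝ) (k T : ℕ) (H : Policy n) : ℝ :=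
  reward v p T H 1 k Finset.univ

/-- A policy is canonical: the L≥R and V+R≥L properties hold at every state. -/
def Canonical {n : ℕ} (v p : Fin n → ℝ) (k T : ℕ) (H : Policy n) : Prop :=
  ∀ t κ : ℕ, ∀ A : Finset (Fin n), 1 ≤ t → t ≤ T → 1 ≤ κ → κ ≤ k → A.Nonempty →
    reward v p T H (t + 1) (κ - 1) (A.erase (H t κ A)) ≤
        reward v p T H (t + 1) κ (A.erase (H t κ A)) ∧
      reward v p T H (t + 1) κ (A.erase (H t κ A)) ≤
        v (H t κ A) + reward v p T H (t + 1) (κ - 1) (A.erase (H t κ A))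

/-- Expected reward of offering to applicant `i` when the continuation values are `W`. -/
noncomputable def offerValue {n : ℕ} (v p : Fin n → ℝ) (W : ℕ → Finset (Fin n) → ℝ)
    (κ : ℕ) (A : Finset (Fin n)) (i : Fin n) : ℝ :=
  p i * (v i + W (κ - 1) (A.erase i)) + (1 - p i) * W κ (A.erase i)

/-- Optimal expected reward with a given number of remaining offers. -/
noncomputable def optValue {n : ℕ} (v p : Fin n → ℝ) : ℕ → ℕ → Finset (Fin n) → ℝ
  | 0, _, _ => 0
  | f + 1, κ, A =>
    if h : κ ≠ 0 ∧ A.Nonempty then A.sup' h.2 (offerValue v p (optValue v p f) κ A) else 0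

section

variable {n : ℕ} {v p : Fin n → ℝ}

theorem optValue_succ (f : ℕ) {κ : ℕ} {A : Finset (Fin n)} (hκ : κ ≠ 0) (hA : A.Nonempty) :
    optValue v p (f + 1) κ A = A.sup' hA (offerValue v p (optValue v p f) κ A) := by
  rw [optValue, dif_pos ⟨hκ, hA⟩]

theorem optValue_eq_zero (f : ℕ) {κ : ℕ} {A : Finset (Fin n)} (h : κ = 0 ∨ A = ∅) :
    optValue v p f κ A = 0 := by
  cases f with
  | zero => rfl
  | succ f =>
    rw [optValue, dif_neg]
    rintro ⟨hκ, hA⟩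
    exact h.elim hκ hA.ne_empty

theorem offerValue_le_optValue (f : ℕ) {κ : ℕ} {A : Finset (Fin n)} {i : Fin n}
    (hκ : κ ≠ 0) (hi : i ∈ A) :
    offerValue v p (optValue v p f) κ A i ≤ optValue v p (f + 1) κ A := by
  rw [optValue_succ f hκ ⟨i, hi⟩]
  exact Finset.le_sup' _ hi

theorem exists_offerValue_eq_optValue (f : ℕ) {κ : ℕ} {A : Finset (Fin n)}
    (hκ : κ ≠ 0) (hA : A.Nonempty) :
    ∃ i ∈ A, offerValue v p (optValue v p f) κ A i = optValue v p (f + 1) κ A := by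
  rw [optValue_succ f hκ hA]
  obtain ⟨i, hi, h⟩ := A.exists_mem_eq_sup' hA (offerValue v p (optValue v p f) κ A)
  exact ⟨i, hi, h.symm⟩

theorem offerValue_le_offerValue (hp : ∀ i, 0 ≤ p i ∧ p i ≤ 1)
    {W W' : ℕ → Finset (Fin n) → ℝ} {κ κ' : ℕ} {A A' : Finset (Fin n)} {i : Fin n}
    (hR : W (κ - 1) (A.erase i) ≤ W' (κ' - 1) (A'.erase i))
    (hL : W κ (A.erase i) ≤ W' κ' (A'.erase i)) :
    offerValue v p W κ A i ≤ offerValue v p W' κ' A' i := by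
  have h0 := (hp i).1
  have h1 := sub_nonneg.2 (hp i).2
  unfold offerValue
  gcongr

theorem optValue_nonneg (hv : ∀ i, 0 ≤ v i) (hp : ∀ i, 0 ≤ p i ∧ p i ≤ 1)
    (f κ : ℕ) (A : Finset (Fin n)) : 0 ≤ optValue v p f κ A := by
  induction f generalizing κ A with
  | zero => exact le_rfl
  | succ f ih =>
    by_cases h : κ = 0 ∨ A = ∅
    · exact (optValue_eq_zero _ h).ge
    · push Not at h
      obtain ⟨i, -, hi⟩ := exists_offerValue_eq_optValue (v := v) (p := p) f h.1 h.2
      rw [← hi]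
      exact add_nonneg (mul_nonneg (hp i).1 (add_nonneg (hv i) (ih _ _)))
        (mul_nonneg (sub_nonneg.2 (hp i).2) (ih _ _))

theorem optValue_mono (hv : ∀ i, 0 ≤ v i) (hp : ∀ i, 0 ≤ p i ∧ p i ≤ 1)
    {f f' κ κ' : ℕ} {A A' : Finset (Fin n)} (hf : f ≤ f') (hκ : κ ≤ κ') (hA : A ⊆ A') :
    optValue v p f κ A ≤ optValue v p f' κ' A' := by
  induction f generalizing f' κ κ' A A' with
  | zero => exact optValue_nonneg hv hp _ _ _
  | succ f ih =>
    by_cases h : κ = 0 ∨ A = ∅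
    · exact (optValue_eq_zero _ h).le.trans (optValue_nonneg hv hp _ _ _)
    · push Not at h
      obtain ⟨g, rfl⟩ : ∃ g, f' = g + 1 := ⟨f' - 1, by omega⟩
      obtain ⟨i, hiA, hi⟩ := exists_offerValue_eq_optValue (v := v) (p := p) f h.1 h.2
      rw [← hi]
      have hA' := Finset.erase_subset_erase i hA
      exact (offerValue_le_offerValue hp (ih (by omega) (by omega) hA')
        (ih (by omega) hκ hA')).trans (offerValue_le_optValue g (by omega) (hA hiA))

theorem exists_optimal_offer_pos_or_eq_zero (hv : ∀ i, 0 ≤ v i) (hp : ∀ i, 0 ≤ p i ∧ p i ≤ 1)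
    (f : ℕ) {κ : ℕ} {A : Finset (Fin n)} (hκ : κ ≠ 0) (hA : A.Nonempty) :
    ∃ i ∈ A, offerValue v p (optValue v p f) κ A i = optValue v p (f + 1) κ A ∧
      (0 < p i ∨ optValue v p (f + 1) κ A = 0) := by
  induction f generalizing A with
  | zero =>
    obtain ⟨i, hiA, hi⟩ := exists_offerValue_eq_optValue (v := v) (p := p) 0 hκ hA
    refine ⟨i, hiA, hi, (hp i).1.lt_or_eq.imp_right fun h => ?_⟩
    rw [← hi]
    simp [offerValue, ← h, optValue]
  | succ f ih =>
    obtain ⟨i, hiA, hi⟩ := exists_offerValue_eq_optValue (v := v) (p := p) (f + 1) hκ hA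
    rcases (hp i).1.lt_or_eq with h | h
    · exact ⟨i, hiA, hi, .inl h⟩
    have hval : optValue v p (f + 1) κ (A.erase i) = optValue v p (f + 1 + 1) κ A := by
      simp [← hi, offerValue, ← h]
    rcases (A.erase i).eq_empty_or_nonempty with he | he
    · exact ⟨i, hiA, hi, .inr (hval ▸ optValue_eq_zero _ (.inr he))⟩
    obtain ⟨j, hjA, hj, hpos⟩ := ih he
    rcases hpos with hpos | h0
    · have hjA' := Finset.mem_of_mem_erase hjA
      refine ⟨j, hjA', le_antisymm (offerValue_le_optValue _ hκ hjA') ?_, .inl hpos⟩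
      have hsub := Finset.erase_subset_erase j (A.erase_subset i)
      rw [← hval, ← hj]
      exact offerValue_le_offerValue hp (optValue_mono hv hp (by omega) le_rfl hsub)
        (optValue_mono hv hp (by omega) le_rfl hsub)
    · exact ⟨i, hiA, hi, .inr (hval ▸ h0)⟩

theorem exists_optimal_offer_canonical (hv : ∀ i, 0 ≤ v i) (hp : ∀ i, 0 ≤ p i ∧ p i ≤ 1)
    (f : ℕ) {κ : ℕ} {A : Finset (Fin n)} (hκ : κ ≠ 0) (hA : A.Nonempty) :
    ∃ i ∈ A, offerValue v p (optValue v p f) κ A i = optValue v p (f + 1) κ A ∧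
      optValue v p f κ (A.erase i) ≤ v i + optValue v p f (κ - 1) (A.erase i) := by
  obtain ⟨i, hiA, hi, h⟩ := exists_optimal_offer_pos_or_eq_zero hv hp f hκ hA
  refine ⟨i, hiA, hi, ?_⟩
  have hmono : optValue v p f κ (A.erase i) ≤ optValue v p (f + 1) κ A :=
    optValue_mono hv hp (by omega) le_rfl (A.erase_subset i)
  rcases h with h | h
  · rw [← hi, offerValue] at hmono
    by_contra! hlt
    nlinarith [mul_pos h (sub_pos.2 hlt)]
  · exact (h ▸ hmono).trans (add_nonneg (hv i) (optValue_nonneg hv hp _ _ _))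

theorem rewardAux_le_optValue (hp : ∀ i, 0 ≤ p i ∧ p i ≤ 1) {k T : ℕ} {H : Policy n}
    (hH : ValidPolicy n k T H) {f t κ : ℕ} (ht : 1 ≤ t) (hf : t + f = T + 1) (hκ : κ ≤ k)
    (A : Finset (Fin n)) : rewardAux v p H f t κ A ≤ optValue v p f κ A := by
  induction f generalizing t κ A with
  | zero => exact le_rfl
  | succ f ih =>
    by_cases h : κ = 0 ∨ A = ∅
    · rw [rewardAux, if_pos h, optValue_eq_zero _ h]
    · rw [rewardAux, if_neg h]
      push Not at h
      have hmem := hH t κ A ht (by omega) (by omega) hκ h.2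
      exact (offerValue_le_offerValue (W := rewardAux v p H f (t + 1)) hp
        (ih (by omega) (by omega) (by omega) _) (ih (by omega) (by omega) hκ _)).trans
        (offerValue_le_optValue f h.1 hmem)

theorem rewardAux_eq_optValue {T : ℕ} {H : Policy n}
    (hH : ∀ t κ A, t ≤ T → κ ≠ 0 → A.Nonempty →
      offerValue v p (optValue v p (T - t)) κ A (H t κ A) = optValue v p (T - t + 1) κ A)
    {f t : ℕ} (hf : t + f = T + 1) (κ : ℕ) (A : Finset (Fin n)) :
    rewardAux v p H f t κ A = optValue v p f κ A := by
  induction f generalizing t κ A with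
  | zero => rfl
  | succ f ih =>
    by_cases h : κ = 0 ∨ A = ∅
    · rw [rewardAux, if_pos h, optValue_eq_zero _ h]
    · rw [rewardAux, if_neg h]
      push Not at h
      have hopt := hH t κ A (by omega) h.1 h.2
      rw [show T - t = f by omega] at hopt
      rw [ih (by omega), ih (by omega), ← hopt, offerValue]

end

/-- For every hiring policy `H` there exists a canonical hiring
policy `H̃` whose total expected reward satisfies `R(H̃) ≥ R(H)`. -/
theorem exists_canonical_policy_dominating
    (n k T : ℕ) (v p : Fin n → ℝ)
    (hk : 1 ≤ k) (hT : 1 ≤ T)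
    (hv : ∀ i, 0 ≤ v i) (hp : ∀ i, 0 ≤ p i ∧ p i ≤ 1)
    (H : Policy n) (hH : ValidPolicy n k T H) :
    ∃ Htilde : Policy n, ValidPolicy n k T Htilde ∧ Canonical v p k T Htilde ∧
      totalReward v p k T H ≤ totalReward v p k T Htilde := by
  classical
  have hex (f κ : ℕ) (A : Finset (Fin n)) (h : κ ≠ 0 ∧ A.Nonempty) :=
    exists_optimal_offer_canonical hv hp f h.1 h.2
  choose g hgA hgopt hgle using hex
  let Ht : Policy n := fun t κ A =>
    if h : κ ≠ 0 ∧ A.Nonempty then g (T - t) κ A h else H t κ A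
  have hHt (t κ : ℕ) (A : Finset (Fin n)) (h : κ ≠ 0 ∧ A.Nonempty) :
      Ht t κ A = g (T - t) κ A h := dif_pos h
  have hopt {f t : ℕ} (hf : t + f = T + 1) (κ : ℕ) (A : Finset (Fin n)) :
      rewardAux v p Ht f t κ A = optValue v p f κ A :=
    rewardAux_eq_optValue (fun t κ A _ hκ hA => by
      rw [hHt t κ A ⟨hκ, hA⟩]
      exact hgopt _ _ _ _) hf κ A
  refine ⟨Ht, fun t κ A _ _ hκ _ hA => ?_, fun t κ A _ ht hκ _ hA => ?_, ?_⟩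
  · rw [hHt t κ A ⟨by omega, hA⟩]
    exact hgA _ _ _ _
  · have hr : T + 1 - (t + 1) = T - t := by omega
    simp only [reward, hr]
    rw [hopt (f := T - t) (by omega), hopt (f := T - t) (by omega), hHt t κ A ⟨by omega, hA⟩]
    exact ⟨optValue_mono hv hp le_rfl (Nat.sub_le _ _) subset_rfl, hgle _ _ _ _⟩
  · unfold totalReward reward
    rw [hopt (f := T + 1 - 1) (by omega)]
    exact rewardAux_le_optValue hp hH le_rfl (by omega) le_rfl _
end

section
/- Let H be a hiring policy that is canonical for the original instance I. Then for every state (t, κ, A) with 1 ≤ t ≤ T+1, 0 ≤ κ ≤ k, A ⊆ [n], one has R^{I↕}_H(t, κ, A) ≥ (1 − ε)·(1 − γ)^{T − t + 1}·R^I_H(t, κ, A). -/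
/-- `(v', p')` are the value/probability vectors of the mixed-rounded instance `I↕`
obtained from `(v, p)` with parameters `ε` and `γ = ε / T`: class-`C₀` applicants
(`p i ≤ γ`) get probability `γ` and value `p i * v i / γ`, while a class-`C_m`
applicant (`(1+ε)^{m-1}·γ < p i ≤ (1+ε)^m·γ`, `m ≥ 1`) gets probability
`(1+ε)^{m-1}·γ` and an unchanged value. -/
def MixedRounded (n : ℕ) (v p : Fin n → ℝ) (ε γ : ℝ) (v' p' : Fin n → ℝ) : Prop :=
  ∀ i : Fin n,
    (p i ≤ γ → p' i = γ ∧ v' i = p i * v i / γ) ∧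
    ∀ m : ℕ, 1 ≤ m → (1 + ε) ^ (m - 1) * γ < p i → p i ≤ (1 + ε) ^ m * γ →
      p' i = (1 + ε) ^ (m - 1) * γ ∧ v' i = v i

theorem rewardAux_nonneg {n : ℕ} {v p : Fin n → ℝ} (hv : ∀ i, 0 ≤ v i)
    (hp : ∀ i, 0 ≤ p i ∧ p i ≤ 1) (H : Policy n) (fuel t κ : ℕ) (A : Finset (Fin n)) :
    0 ≤ rewardAux v p H fuel t κ A := by
  induction fuel generalizing t κ A with
  | zero => simp [rewardAux]
  | succ fuel ih =>
    rw [rewardAux]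
    split_ifs
    · rfl
    · have := sub_nonneg.2 (hp (H t κ A)).2
      have := (hp (H t κ A)).1
      have := hv (H t κ A)
      have := ih (t + 1) (κ - 1) (A.erase (H t κ A))
      have := ih (t + 1) κ (A.erase (H t κ A))
      positivity

theorem reward_nonneg {n : ℕ} {v p : Fin n → ℝ} (hv : ∀ i, 0 ≤ v i)
    (hp : ∀ i, 0 ≤ p i ∧ p i ≤ 1) (T : ℕ) (H : Policy n) (t κ : ℕ) (A : Finset (Fin n)) :
    0 ≤ reward v p T H t κ A :=
  rewardAux_nonneg hv hp H _ t κ A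

theorem reward_eq_zero {n : ℕ} (v p : Fin n → ℝ) (T : ℕ) (H : Policy n) {t κ : ℕ}
    {A : Finset (Fin n)} (h : κ = 0 ∨ A = ∅) : reward v p T H t κ A = 0 := by
  rw [reward]
  cases T + 1 - t with
  | zero => rfl
  | succ fuel => rw [rewardAux, if_pos h]

theorem reward_step {n : ℕ} (v p : Fin n → ℝ) {T : ℕ} (H : Policy n) {t κ : ℕ}
    {A : Finset (Fin n)} (ht : t ≤ T) (h : ¬(κ = 0 ∨ A = ∅)) :
    reward v p T H t κ A =
      p (H t κ A) * (v (H t κ A) + reward v p T H (t + 1) (κ - 1) (A.erase (H t κ A))) +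
        (1 - p (H t κ A)) * reward v p T H (t + 1) κ (A.erase (H t κ A)) := by
  rw [reward, Nat.succ_sub ht, rewardAux, if_neg h]
  simp only [reward, Nat.add_sub_add_right]

/-- Every number above `γ` lies in one of the geometric classes above `γ`. -/
theorem exists_geometric_class {ε γ x : ℝ} (hε : 0 < ε) (hγ : 0 < γ) (hx : γ < x) :
    ∃ m : ℕ, 1 ≤ m ∧ (1 + ε) ^ (m - 1) * γ < x ∧ x ≤ (1 + ε) ^ m * γ := by
  classical
  have hex : ∃ m : ℕ, x ≤ (1 + ε) ^ m * γ := by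
    obtain ⟨m, hm⟩ := pow_unbounded_of_one_lt (x / γ) (by linarith : 1 < 1 + ε)
    exact ⟨m, ((div_lt_iff₀ hγ).1 hm).le⟩
  have hpos : 1 ≤ Nat.find hex := by
    rw [Nat.one_le_iff_ne_zero]
    intro h0
    have := Nat.find_spec hex
    rw [h0, pow_zero, one_mul] at this
    linarith
  exact ⟨Nat.find hex, hpos, not_le.1 (Nat.find_min hex (by omega)), Nat.find_spec hex⟩

/-- Each mixed-rounded applicant either comes from class `C₀`, or keeps its value while its
probability decreases by a factor of at most `1 + ε`. -/
theorem MixedRounded.cases {n : ℕ} {v p v' p' : Fin n → ℝ} {ε γ : ℝ}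
    (hmix : MixedRounded n v p ε γ v' p') (hε : 0 < ε) (hγ : 0 < γ) (i : Fin n) :
    (p i ≤ γ ∧ p' i = γ ∧ p' i * v' i = p i * v i) ∨
      (0 ≤ p' i ∧ p' i ≤ p i ∧ p i ≤ (1 + ε) * p' i ∧ v' i = v i) := by
  rcases le_or_gt (p i) γ with h | h
  · obtain ⟨h1, h2⟩ := (hmix i).1 h
    refine Or.inl ⟨h, h1, ?_⟩
    rw [h1, h2, mul_div_cancel₀ _ hγ.ne']
  · obtain ⟨m, hm, hlt, hle⟩ := exists_geometric_class hε hγ h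
    obtain ⟨h1, h2⟩ := (hmix i).2 m hm hlt hle
    refine Or.inr ⟨by rw [h1]; positivity, by rw [h1]; exact hlt.le, ?_, h2⟩
    rw [h1, ← mul_assoc, ← pow_succ', Nat.sub_add_cancel hm]
    exact hle

/-- One-step bound for an applicant whose small probability is rounded up to `γ`. -/
theorem step_bound_small {c γ v p v' L R : ℝ} (hc0 : 0 ≤ c) (hc1 : c ≤ 1) (hγ0 : 0 ≤ γ)
    (hγ1 : γ ≤ 1) (hv : 0 ≤ v) (hp : 0 ≤ p) (hv' : γ * v' = p * v)
    (hR : 0 ≤ R) (hRL : R ≤ L) :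
    c * (1 - γ) * (p * (v + R) + (1 - p) * L) ≤ γ * (v' + c * R) + (1 - γ) * (c * L) := by
  have h1 : 0 ≤ (1 - c * (1 - γ)) * (p * v) :=
    mul_nonneg (by nlinarith) (mul_nonneg hp hv)
  have h2 : 0 ≤ γ * c * R := by positivity
  have h3 : 0 ≤ c * (1 - γ) * p * (L - R) :=
    mul_nonneg (mul_nonneg (mul_nonneg hc0 (by linarith)) hp) (by linarith)
  linarith

/-- One-step bound for an applicant whose probability is rounded down by a factor of
at most `1 + ε`. -/
theorem step_bound_large {c ε v p p' L R : ℝ} (hε0 : 0 < ε) (hc0 : 0 ≤ c) (hc1 : c ≤ 1 - ε)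
    (hp' : 0 ≤ p') (hpp' : p ≤ (1 + ε) * p') (hRL : R ≤ L) (hLv : L ≤ v + R) :
    c * (p * (v + R) + (1 - p) * L) ≤ p' * (v + c * R) + (1 - p') * (c * L) := by
  have h1 : 0 ≤ p' * ((1 - c) * (L - R)) :=
    mul_nonneg hp' (mul_nonneg (by linarith) (by linarith))
  have h2 : c * p ≤ p' :=
    calc c * p ≤ c * ((1 + ε) * p') := mul_le_mul_of_nonneg_left hpp' hc0
      _ ≤ (1 - ε) * ((1 + ε) * p') := mul_le_mul_of_nonneg_right hc1 (by positivity)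
      _ ≤ p' := by nlinarith [mul_nonneg (sq_nonneg ε) hp']
  have h3 : 0 ≤ (p' - c * p) * (v + R - L) :=
    mul_nonneg (by linarith) (by linarith)
  linarith

/-- If `H` is canonical for the original instance `I`, then at
every state, `R^{I↕}_H(t, κ, A) ≥ (1 − ε)·(1 − γ)^{T − t + 1}·R^I_H(t, κ, A)`. -/
theorem canonical_reward_mixed_rounded_statewise_lower_bound
    (n k T : ℕ) (v p v' p' : Fin n → ℝ) (ε γ : ℝ)
    (hk : 1 ≤ k) (hT : 1 ≤ T)
    (hv : ∀ i, 0 ≤ v i) (hp : ∀ i, 0 ≤ p i ∧ p i ≤ 1)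
    (hε0 : 0 < ε) (hε1 : ε < 1) (hγ : γ = ε / T) (hγ1 : γ < 1)
    (hmix : MixedRounded n v p ε γ v' p')
    (H : Policy n) (hH : ValidPolicy n k T H)
    (hcan : Canonical v p k T H) :
    ∀ t κ : ℕ, ∀ A : Finset (Fin n), 1 ≤ t → t ≤ T + 1 → κ ≤ k →
      (1 - ε) * (1 - γ) ^ (T + 1 - t) * reward v p T H t κ A ≤
        reward v' p' T H t κ A := by
  have hγ0 : 0 < γ := by
    have : (0 : ℝ) < T := by exact_mod_cast hT
    rw [hγ]
    positivity
  suffices hs : ∀ s t κ : ℕ, ∀ A : Finset (Fin n), 1 ≤ t → t + s = T + 1 → κ ≤ k →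
      (1 - ε) * (1 - γ) ^ s * reward v p T H t κ A ≤ reward v' p' T H t κ A by
    intro t κ A ht htT hκ
    exact hs (T + 1 - t) t κ A ht (by omega) hκ
  intro s
  induction s with
  | zero =>
    intro t κ A _ hts _
    simp [reward, ← hts, rewardAux]
  | succ s ih =>
    intro t κ A ht hts hκ
    by_cases hend : κ = 0 ∨ A = ∅
    · rw [reward_eq_zero v p T H hend, reward_eq_zero v' p' T H hend, mul_zero]
    have htT : t ≤ T := by omega
    obtain ⟨hκ0, hA⟩ := not_or.1 hend
    obtain ⟨hRL, hLv⟩ := hcan t κ A ht htT (by omega) hκ (Finset.nonempty_iff_ne_empty.2 hA)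
    have ihR := ih (t + 1) (κ - 1) (A.erase (H t κ A)) (by omega) (by omega) (by omega)
    have ihL := ih (t + 1) κ (A.erase (H t κ A)) (by omega) (by omega) hκ
    have hnonneg := reward_nonneg hv hp T H t κ A
    have hR := reward_nonneg hv hp T H (t + 1) (κ - 1) (A.erase (H t κ A))
    rw [reward_step v p H htT hend] at hnonneg ⊢
    rw [reward_step v' p' H htT hend]
    obtain ⟨hpi0, hpi1⟩ := hp (H t κ A)
    have hvi := hv (H t κ A)
    have hcases := hmix.cases hε0 hγ0 (H t κ A)
    generalize H t κ A = i at *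
    have hc0 : 0 ≤ (1 - ε) * (1 - γ) ^ s :=
      mul_nonneg (by linarith) (pow_nonneg (by linarith) s)
    have hc1 : (1 - ε) * (1 - γ) ^ s ≤ 1 - ε :=
      mul_le_of_le_one_right (by linarith) (pow_le_one₀ (by linarith) (by linarith))
    rw [pow_succ, ← mul_assoc]
    generalize (1 - ε) * (1 - γ) ^ s = c at *
    have hp' : 0 ≤ p' i ∧ p' i ≤ 1 := by
      rcases hcases with ⟨_, h, _⟩ | ⟨h0, h1, _⟩
      · rw [h]
        exact ⟨hγ0.le, hγ1.le⟩
      · exact ⟨h0, h1.trans hpi1⟩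
    refine le_trans ?_ (add_le_add
      (mul_le_mul_of_nonneg_left (add_le_add_right ihR (v' i)) hp'.1)
      (mul_le_mul_of_nonneg_left ihL (sub_nonneg.2 hp'.2)))
    rcases hcases with ⟨_, hpγ, hpv⟩ | ⟨h0, _, h2, hveq⟩
    · rw [hpγ] at hpv ⊢
      exact step_bound_small hc0 (by linarith) hγ0.le hγ1.le hvi hpi0 hpv hR hRL
    · rw [hveq]
      refine le_trans (mul_le_mul_of_nonneg_right ?_ hnonneg)
        (step_bound_large hε0 hc0 hc1 h0 h2 hRL hLv)
      exact mul_le_of_le_one_right hc0 (by linarith)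
end

section
/- Suppose the applicants of a sequential hiring instance are partitioned into classes C_0, …, C_M such that any two applicants in the same class have equal acceptance probability. Then there exists a hiring policy H maximizing the total expected reward R(H) over all hiring policies that follows the order-by-value rule: at every state (t, κ, A), the chosen applicant H(t, κ, A) has the highest value among the currently available applicants in its class, i.e., if H(t, κ, A) ∈ C_m then v_{H(t,κ,A)} = max{v_i : i ∈ A ∩ C_m}. -/
/-- Expected reward of approaching applicant `i` in the state `(κ, A)` when the continuation
values are given by `W`. -/
noncomputable def approachValue {n : ℕ} (v p : Fin n → ℝ) (W : ℕ → Finset (Fin n) → ℝ)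
    (κ : ℕ) (A : Finset (Fin n)) (i : Fin n) : ℝ :=
  p i * (v i + W (κ - 1) (A.erase i)) + (1 - p i) * W κ (A.erase i)

/-- The value function of the dynamic program, indexed by the number of remaining steps. -/
noncomputable def optimalValue {n : ℕ} (v p : Fin n → ℝ) : ℕ → ℕ → Finset (Fin n) → ℝ
  | 0, _, _ => 0
  | s + 1, κ, A =>
    if h : κ ≠ 0 ∧ A.Nonempty then A.sup' h.2 (approachValue v p (optimalValue v p s) κ A)
    else 0

theorem approachValue_le_optimalValue {n : ℕ} (v p : Fin n → ℝ) (s : ℕ) {κ : ℕ} (hκ : κ ≠ 0)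
    {A : Finset (Fin n)} {i : Fin n} (hi : i ∈ A) :
    approachValue v p (optimalValue v p s) κ A i ≤ optimalValue v p (s + 1) κ A := by
  rw [optimalValue, dif_pos ⟨hκ, i, hi⟩]
  exact Finset.le_sup' _ hi

theorem approachValue_le_add {n : ℕ} {v p : Fin n → ℝ} {W W' : ℕ → Finset (Fin n) → ℝ}
    {κ : ℕ} {A A' : Finset (Fin n)} {i : Fin n} {d : ℝ} (hp : 0 ≤ p i ∧ p i ≤ 1)
    (h : ∀ κ' ≤ κ, W κ' (A.erase i) ≤ W' κ' (A'.erase i) + d) :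
    approachValue v p W κ A i ≤ approachValue v p W' κ A' i + d := by
  have h1 := mul_le_mul_of_nonneg_left (h (κ - 1) (Nat.sub_le _ _)) hp.1
  have h2 := mul_le_mul_of_nonneg_left (h κ le_rfl) (sub_nonneg.2 hp.2)
  unfold approachValue
  linarith

/-- Replacing an available applicant by a better one with the same acceptance probability
increases the optimal value by at most the expected gain of hiring that applicant. -/
theorem optimalValue_insert_le {n : ℕ} {v p : Fin n → ℝ} (hp : ∀ i, 0 ≤ p i ∧ p i ≤ 1)
    {i j : Fin n} (hij : p i = p j) (hv : v i ≤ v j) (s κ : ℕ) {B : Finset (Fin n)}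
    (hi : i ∉ B) (hj : j ∉ B) :
    optimalValue v p s κ (insert j B) ≤
      optimalValue v p s κ (insert i B) + p i * (v j - v i) := by
  have hd : 0 ≤ p i * (v j - v i) := mul_nonneg (hp i).1 (sub_nonneg.2 hv)
  induction s generalizing κ B with
  | zero => simpa [optimalValue] using hd
  | succ s ih =>
    by_cases hκ : κ = 0
    · simpa [optimalValue, hκ] using hd
    rw [optimalValue, dif_pos ⟨hκ, Finset.insert_nonempty _ _⟩]
    refine Finset.sup'_le _ _ fun x hx => ?_
    rcases Finset.mem_insert.1 hx with rfl | hx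
    · refine le_trans (le_of_eq ?_) (add_le_add_left
        (approachValue_le_optimalValue v p s hκ (Finset.mem_insert_self i B)) _)
      simp only [approachValue, Finset.erase_insert hi, Finset.erase_insert hj, hij]
      ring
    · refine le_trans (approachValue_le_add (hp x) fun κ' _ => ?_) (add_le_add_left
        (approachValue_le_optimalValue v p s hκ (Finset.mem_insert_of_mem hx)) _)
      rw [Finset.erase_insert_of_ne (ne_of_mem_of_not_mem hx hj).symm,
        Finset.erase_insert_of_ne (ne_of_mem_of_not_mem hx hi).symm]
      exact ih _ (fun h => hi (Finset.mem_of_mem_erase h))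
        (fun h => hj (Finset.mem_of_mem_erase h))

/-- Between two applicants with the same acceptance probability, it is at least as good to
approach the one of higher value first. -/
theorem approachValue_mono_of_eq_prob {n : ℕ} {v p : Fin n → ℝ}
    (hp : ∀ i, 0 ≤ p i ∧ p i ≤ 1) {i j : Fin n} (hij : p i = p j) (hv : v i ≤ v j)
    (s κ : ℕ) {A : Finset (Fin n)} (hi : i ∈ A) (hj : j ∈ A) :
    approachValue v p (optimalValue v p s) κ A i ≤
      approachValue v p (optimalValue v p s) κ A j := by
  rcases eq_or_ne i j with rfl | hne
  · exact le_rfl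
  have hAi : A.erase i = insert j ((A.erase i).erase j) :=
    (Finset.insert_erase (Finset.mem_erase.2 ⟨hne.symm, hj⟩)).symm
  have hAj : A.erase j = insert i ((A.erase i).erase j) := by
    rw [Finset.erase_right_comm, Finset.insert_erase (Finset.mem_erase.2 ⟨hne, hi⟩)]
  have key (κ' : ℕ) : optimalValue v p s κ' (A.erase i) ≤
      optimalValue v p s κ' (A.erase j) + p i * (v j - v i) := by
    rw [hAi, hAj]
    exact optimalValue_insert_le hp hij hv s κ' (by simp) (by simp)
  have h1 := mul_le_mul_of_nonneg_left (key (κ - 1)) (hp i).1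
  have h2 := mul_le_mul_of_nonneg_left (key κ) (sub_nonneg.2 (hp i).2)
  unfold approachValue
  rw [← hij]
  linarith

theorem rewardAux_succ {n : ℕ} (v p : Fin n → ℝ) (H : Policy n) (s t : ℕ) {κ : ℕ}
    (hκ : κ ≠ 0) {A : Finset (Fin n)} (hA : A.Nonempty) :
    rewardAux v p H (s + 1) t κ A =
      approachValue v p (rewardAux v p H s (t + 1)) κ A (H t κ A) := by
  rw [rewardAux, if_neg (not_or.2 ⟨hκ, hA.ne_empty⟩), approachValue]

theorem rewardAux_le_optimalValue {n k T : ℕ} {v p : Fin n → ℝ}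
    (hp : ∀ i, 0 ≤ p i ∧ p i ≤ 1) {H : Policy n} (hH : ValidPolicy n k T H)
    (s t κ : ℕ) (A : Finset (Fin n)) (ht : 1 ≤ t) (hs : t + s = T + 1) (hk : κ ≤ k) :
    rewardAux v p H s t κ A ≤ optimalValue v p s κ A := by
  induction s generalizing t κ A with
  | zero => simp [rewardAux, optimalValue]
  | succ s ih =>
    by_cases h : κ ≠ 0 ∧ A.Nonempty
    · rw [rewardAux_succ v p H s t h.1 h.2]
      refine le_trans ?_ (approachValue_le_optimalValue v p s h.1
        (hH t κ A ht (by omega) (Nat.one_le_iff_ne_zero.2 h.1) hk h.2))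
      simpa using approachValue_le_add (d := 0) (hp _) fun κ' hκ' => by
        simpa using ih (t + 1) κ' (A.erase (H t κ A)) (by omega) (by omega) (hκ'.trans hk)
    · rw [optimalValue, dif_neg h, rewardAux, if_pos]
      rw [← Finset.not_nonempty_iff_eq_empty]
      tauto

theorem optimalValue_le_rewardAux {n T : ℕ} {v p : Fin n → ℝ}
    (hp : ∀ i, 0 ≤ p i ∧ p i ≤ 1) {H : Policy n}
    (hH : ∀ t κ : ℕ, ∀ A : Finset (Fin n), A.Nonempty → ∀ i ∈ A,
      approachValue v p (optimalValue v p (T - t)) κ A i ≤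
        approachValue v p (optimalValue v p (T - t)) κ A (H t κ A))
    (s t κ : ℕ) (A : Finset (Fin n)) (hs : t + s = T + 1) :
    optimalValue v p s κ A ≤ rewardAux v p H s t κ A := by
  induction s generalizing t κ A with
  | zero => simp [rewardAux, optimalValue]
  | succ s ih =>
    by_cases h : κ ≠ 0 ∧ A.Nonempty
    · rw [rewardAux_succ v p H s t h.1 h.2, optimalValue, dif_pos h]
      obtain rfl : s = T - t := by omega
      refine Finset.sup'_le _ _ fun i hi => (hH t κ A h.2 i hi).trans ?_
      simpa using approachValue_le_add (d := 0) (hp _) fun κ' _ => by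
        simpa using ih (t + 1) κ' (A.erase (H t κ A)) (by omega)
    · rw [optimalValue, dif_neg h, rewardAux, if_pos]
      rw [← Finset.not_nonempty_iff_eq_empty]
      tauto

/-- If the applicants are partitioned into classes (indexed by the
class map `c`) so that applicants in the same class have equal acceptance
probability, then there exists an optimal hiring policy following the
order-by-value rule: the chosen applicant always has the highest value among the
available applicants of its class. -/
theorem exists_order_by_value_optimal_policy
    (n k T : ℕ) (v p : Fin n → ℝ)
    (hn : 1 ≤ n) (hk : 1 ≤ k) (hT : 1 ≤ T)
    (hv : ∀ i, 0 ≤ v i) (hp : ∀ i, 0 ≤ p i ∧ p i ≤ 1)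
    (c : Fin n → ℕ) (hc : ∀ i j, c i = c j → p i = p j) :
    ∃ H : Policy n, ValidPolicy n k T H ∧
      (∀ H' : Policy n, ValidPolicy n k T H' →
        totalReward v p k T H' ≤ totalReward v p k T H) ∧
      (∀ t κ : ℕ, ∀ A : Finset (Fin n),
        1 ≤ t → t ≤ T → 1 ≤ κ → κ ≤ k → A.Nonempty →
        ∀ i ∈ A, c i = c (H t κ A) → v i ≤ v (H t κ A)) := by
  have hex (t κ : ℕ) (A : Finset (Fin n)) : ∃ x, A.Nonempty → x ∈ A ∧ ∀ i ∈ A,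
      toLex (approachValue v p (optimalValue v p (T - t)) κ A i, v i) ≤
        toLex (approachValue v p (optimalValue v p (T - t)) κ A x, v x) := by
    by_cases hA : A.Nonempty
    · obtain ⟨x, hx, hmax⟩ := A.exists_max_image
        (fun i => toLex (approachValue v p (optimalValue v p (T - t)) κ A i, v i)) hA
      exact ⟨x, fun _ => ⟨hx, hmax⟩⟩
    · exact ⟨⟨0, hn⟩, fun h => absurd h hA⟩
  choose H hH using hex
  refine ⟨H, fun t κ A _ _ _ _ hA => (hH t κ A hA).1, fun H' hH' => ?_, ?_⟩
  · refine (rewardAux_le_optimalValue hp hH' _ 1 k Finset.univ le_rfl (by omega) le_rfl).trans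
      (optimalValue_le_rewardAux (T := T) hp (fun t κ A hA i hi => ?_) _ 1 k Finset.univ (by omega))
    rcases Prod.Lex.toLex_le_toLex.1 ((hH t κ A hA).2 i hi) with h | h
    exacts [h.le, h.1.le]
  · intro t κ A _ _ _ _ hA i hi hci
    by_contra! hlt
    have hle := approachValue_mono_of_eq_prob hp (hc _ _ hci.symm) hlt.le (T - t) κ
      (hH t κ A hA).1 hi
    rcases Prod.Lex.toLex_le_toLex.1 ((hH t κ A hA).2 i hi) with h | h
    exacts [hle.not_gt h, hlt.not_ge h.2]
end

section
/- Let H^B be a block-responsive policy that is canonical for the mixed-rounded instance I↕. Then R^I(H^B) ≥ R^{I↕}(H^B). -/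
/-- A block-responsive policy: assigns to every state an ordered list (block) of
applicants. -/
def BlockPolicy (n : ℕ) : Type := ℕ → ℕ → Finset (Fin n) → List (Fin n)

/-- Validity of a block-responsive policy: at every state `(t, κ, A)` with
`1 ≤ t ≤ T`, `1 ≤ κ ≤ k`, `A ≠ ∅`, the chosen block is a nonempty list of
distinct available applicants whose length `m` satisfies `t + m ≤ T + 1`. -/
def ValidBlockPolicy (n k T : ℕ) (HB : BlockPolicy n) : Prop :=
  ∀ t κ : ℕ, ∀ A : Finset (Fin n), 1 ≤ t → t ≤ T → 1 ≤ κ → κ ≤ k → A.Nonempty →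
    HB t κ A ≠ [] ∧ (HB t κ A).Nodup ∧ (∀ i ∈ HB t κ A, i ∈ A) ∧
      t + (HB t κ A).length ≤ T + 1

/-- Sequentially extending offers within a block: `left` is collected when everyone
rejects, `v i + right` when applicant `i` is the first to accept. -/
noncomputable def seqReward {n : ℕ} (v p : Fin n → ℝ) :
    List (Fin n) → ℝ → ℝ → ℝ
  | [], left, _ => left
  | i :: rest, left, right =>
      p i * (v i + right) + (1 - p i) * seqReward v p rest left right

/-- Expected reward of a block-responsive policy, with explicit fuel `T + 1 - t`. -/
noncomputable def blockRewardAux {n : ℕ} (v p : Fin n → ℝ) (HB : BlockPolicy n)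
    (fuel t κ : ℕ) (A : Finset (Fin n)) : ℝ :=
  if h : fuel = 0 ∨ κ = 0 ∨ A = ∅ then 0
  else
    seqReward v p (HB t κ A)
      (blockRewardAux v p HB (fuel - max (HB t κ A).length 1)
        (t + (HB t κ A).length) κ (A \ (HB t κ A).toFinset))
      (blockRewardAux v p HB (fuel - max (HB t κ A).length 1)
        (t + (HB t κ A).length) (κ - 1) (A \ (HB t κ A).toFinset))
termination_by fuel
decreasing_by
  all_goals
    push_neg at h
    have h2 := Nat.le_max_right (HB t κ A).length 1
    omega

/-- Expected reward `R_{H^B}(t, κ, A)` of a block-responsive policy from a state;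
it vanishes as soon as `t = T + 1`, `κ = 0`, or `A = ∅`. -/
noncomputable def blockReward {n : ℕ} (v p : Fin n → ℝ) (T : ℕ) (HB : BlockPolicy n)
    (t κ : ℕ) (A : Finset (Fin n)) : ℝ :=
  blockRewardAux v p HB (T + 1 - t) t κ A

/-- Total expected reward `R(H^B) = R_{H^B}(1, k, [n])`. -/
noncomputable def blockTotalReward {n : ℕ} (v p : Fin n → ℝ) (k T : ℕ)
    (HB : BlockPolicy n) : ℝ :=
  blockReward v p T HB 1 k Finset.univ

/-- Tail reward `R_{H^B}(t, κ, A; r)`: offers start from the `r`-th applicant of the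
block chosen at `(t, κ, A)`. -/
noncomputable def blockTail {n : ℕ} (v p : Fin n → ℝ) (T : ℕ) (HB : BlockPolicy n)
    (t κ : ℕ) (A : Finset (Fin n)) (r : ℕ) : ℝ :=
  seqReward v p ((HB t κ A).drop (r - 1))
    (blockReward v p T HB (t + (HB t κ A).length) κ (A \ (HB t κ A).toFinset))
    (blockReward v p T HB (t + (HB t κ A).length) (κ - 1) (A \ (HB t κ A).toFinset))

/-- A block-responsive policy is canonical: the L≥R-block and V+R≥L-block
properties hold at every state and every rank `r = q + 1` (with `q < m`). -/
def CanonicalBlock {n : ℕ} (v p : Fin n → ℝ) (k T : ℕ) (HB : BlockPolicy n) : Prop :=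
  ∀ t κ : ℕ, ∀ A : Finset (Fin n), 1 ≤ t → t ≤ T → 1 ≤ κ → κ ≤ k → A.Nonempty →
    ∀ q : ℕ, ∀ hq : q < (HB t κ A).length,
      blockReward v p T HB (t + (HB t κ A).length) (κ - 1)
            (A \ (HB t κ A).toFinset) ≤
          blockTail v p T HB t κ A (q + 2) ∧
        blockTail v p T HB t κ A (q + 2) ≤
          v ((HB t κ A).get ⟨q, hq⟩) +
            blockReward v p T HB (t + (HB t κ A).length) (κ - 1)
              (A \ (HB t κ A).toFinset)

/-- Replacing `(v', p')` by `(v, p)` for a single applicant does not decrease the expected reward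
of any offer whose continuation rewards `left`, `right` satisfy `right ≤ left ≤ v' i + right`. -/
theorem MixedRounded.offer_le {n : ℕ} {v p v' p' : Fin n → ℝ} {ε γ : ℝ}
    (hmix : MixedRounded n v p ε γ v' p') (hε : 0 < ε) (hγ : 0 < γ) (i : Fin n)
    {left right : ℝ} (hright : right ≤ left) (hleft : left ≤ v' i + right) :
    p' i * (v' i + right) + (1 - p' i) * left ≤ p i * (v i + right) + (1 - p i) * left := by
  rcases le_or_gt (p i) γ with hpγ | hpγ
  · obtain ⟨hp', hv'⟩ := (hmix i).1 hpγ
    have hpv : p' i * v' i = p i * v i := by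
      rw [hp', hv']
      field_simp
    have hle : p i ≤ p' i := hp' ▸ hpγ
    nlinarith [mul_nonneg (sub_nonneg.2 hle) (sub_nonneg.2 hright)]
  · classical
    have hex : ∃ m : ℕ, p i ≤ (1 + ε) ^ m * γ := by
      obtain ⟨m, hm⟩ := pow_unbounded_of_one_lt (p i / γ) (show 1 < 1 + ε by linarith)
      exact ⟨m, ((div_lt_iff₀ hγ).1 hm).le⟩
    have hpos : 1 ≤ Nat.find hex := by
      refine Nat.one_le_iff_ne_zero.2 fun h0 => ?_
      have hspec := Nat.find_spec hex
      rw [h0, pow_zero, one_mul] at hspec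
      exact absurd hspec (not_le.2 hpγ)
    have hlt : (1 + ε) ^ (Nat.find hex - 1) * γ < p i :=
      not_le.1 (Nat.find_min hex (Nat.sub_lt hpos one_pos))
    obtain ⟨hp', hv'⟩ := (hmix i).2 _ hpos hlt (Nat.find_spec hex)
    rw [← hp'] at hlt
    rw [hv'] at hleft ⊢
    nlinarith [mul_nonneg (sub_nonneg.2 hlt.le) (sub_nonneg.2 hleft)]

/-- `seqReward` for `(v', p')` is at most `seqReward` for `(v, p)` along a list that satisfies the
two canonical inequalities at each position. -/
theorem MixedRounded.seqReward_le {n : ℕ} {v p v' p' : Fin n → ℝ} {ε γ : ℝ}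
    (hmix : MixedRounded n v p ε γ v' p') (hε : 0 < ε) (hγ : 0 < γ)
    (hp : ∀ i, 0 ≤ p i ∧ p i ≤ 1) {left left' right right' : ℝ}
    (hleft : left' ≤ left) (hright : right' ≤ right) (l : List (Fin n))
    (hcan : ∀ (q : ℕ) (hq : q < l.length),
      right' ≤ seqReward v' p' (l.drop (q + 1)) left' right' ∧
        seqReward v' p' (l.drop (q + 1)) left' right' ≤ v' (l.get ⟨q, hq⟩) + right') :
    seqReward v' p' l left' right' ≤ seqReward v p l left right := by
  induction l with
  | nil => simpa [seqReward] using hleft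
  | cons i rest ih =>
    have htail := ih fun q hq => by simpa using hcan (q + 1) (by simpa using hq)
    obtain ⟨hlow, hupp⟩ := hcan 0 (by simp)
    simp only [zero_add, List.drop_succ_cons, List.drop_zero, List.get_eq_getElem,
      List.getElem_cons_zero] at hlow hupp
    have hoffer := hmix.offer_le hε hγ i hlow hupp
    obtain ⟨hp0, hp1⟩ := hp i
    simp only [seqReward]
    nlinarith [mul_le_mul_of_nonneg_left hright hp0,
      mul_le_mul_of_nonneg_left htail (sub_nonneg.2 hp1)]

theorem blockReward_eq_zero {n : ℕ} (v p : Fin n → ℝ) {T : ℕ} (HB : BlockPolicy n) {t κ : ℕ}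
    {A : Finset (Fin n)} (h : T < t ∨ κ = 0 ∨ A = ∅) : blockReward v p T HB t κ A = 0 := by
  rw [blockReward, blockRewardAux, dif_pos]
  exact h.imp_left fun _ => by omega

theorem blockReward_eq_seqReward {n : ℕ} (v p : Fin n → ℝ) {T : ℕ} (HB : BlockPolicy n)
    {t κ : ℕ} {A : Finset (Fin n)} (ht : t ≤ T) (hκ : 1 ≤ κ) (hA : A.Nonempty)
    (hne : HB t κ A ≠ []) :
    blockReward v p T HB t κ A =
      seqReward v p (HB t κ A)
        (blockReward v p T HB (t + (HB t κ A).length) κ (A \ (HB t κ A).toFinset))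
        (blockReward v p T HB (t + (HB t κ A).length) (κ - 1) (A \ (HB t κ A).toFinset)) := by
  have hlen := List.length_pos_of_ne_nil hne
  have hfuel : T + 1 - t - max (HB t κ A).length 1 = T + 1 - (t + (HB t κ A).length) := by
    omega
  have hcond : ¬(T + 1 - t = 0 ∨ κ = 0 ∨ A = ∅) := by
    rintro (h | h | h)
    · omega
    · omega
    · exact hA.ne_empty h
  rw [blockReward, blockRewardAux, dif_neg hcond, hfuel]
  rfl

/-- From every state, the expected reward of a canonical policy for the mixed-rounded instance is
at most its expected reward for the original instance. -/
theorem MixedRounded.blockReward_le {n k T : ℕ} {v p v' p' : Fin n → ℝ} {ε γ : ℝ}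
    (hmix : MixedRounded n v p ε γ v' p') (hε : 0 < ε) (hγ : 0 < γ)
    (hp : ∀ i, 0 ≤ p i ∧ p i ≤ 1) {HB : BlockPolicy n} (hHB : ValidBlockPolicy n k T HB)
    (hcan : CanonicalBlock v' p' k T HB) (t κ : ℕ) (A : Finset (Fin n)) (ht : 1 ≤ t)
    (hκ : κ ≤ k) : blockReward v' p' T HB t κ A ≤ blockReward v p T HB t κ A := by
  induction hf : T + 1 - t using Nat.strong_induction_on generalizing t κ A with
  | _ f ih =>
    by_cases h : T < t ∨ κ = 0 ∨ A = ∅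
    · rw [blockReward_eq_zero v' p' HB h, blockReward_eq_zero v p HB h]
    · push Not at h
      obtain ⟨htT, hκ0, hA⟩ := h
      have hκ1 := Nat.one_le_iff_ne_zero.2 hκ0
      have hne := (hHB t κ A ht htT hκ1 hκ hA).1
      have hlen := List.length_pos_of_ne_nil hne
      rw [blockReward_eq_seqReward v' p' HB htT hκ1 hA hne,
        blockReward_eq_seqReward v p HB htT hκ1 hA hne]
      exact hmix.seqReward_le hε hγ hp
        (ih _ (by omega) _ _ _ (by omega) hκ rfl)
        (ih _ (by omega) _ _ _ (by omega) (by omega) rfl) _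
        (hcan t κ A ht htT hκ1 hκ hA)

/-- If the block-responsive policy `H^B` is canonical for the
mixed-rounded instance `I↕`, then `R^I(H^B) ≥ R^{I↕}(H^B)`. -/
theorem canonical_block_mixed_rounded_reward_dominated
    (n k T : ℕ) (v p v' p' : Fin n → ℝ) (ε γ : ℝ)
    (hk : 1 ≤ k) (hT : 1 ≤ T)
    (hv : ∀ i, 0 ≤ v i) (hp : ∀ i, 0 ≤ p i ∧ p i ≤ 1)
    (hε0 : 0 < ε) (hε1 : ε < 1) (hγ : γ = ε / T) (hγ1 : γ < 1)
    (hmix : MixedRounded n v p ε γ v' p')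
    (HB : BlockPolicy n) (hHB : ValidBlockPolicy n k T HB)
    (hcan : CanonicalBlock v' p' k T HB) :
    blockTotalReward v' p' k T HB ≤ blockTotalReward v p k T HB := by
  have hγ0 : 0 < γ := by
    rw [hγ]
    exact div_pos hε0 (by exact_mod_cast hT)
  exact hmix.blockReward_le hε0 hγ0 hp hHB hcan 1 k Finset.univ le_rfl le_rfl
end
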